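/- Let k be a field, let n ≥ 1 be an integer, and let k(Kₙ) = k[x₁, …, xₙ]/(x_i x_j : 1 ≤ i < j ≤ n) be the edge ring of the complete graph Kₙ. If r ≥ 1 is the smallest integer such that n ≤ r(r+1)/2 (i.e., (r+1 choose 2) is the smallest triangular number with n ≤ (r+1 choose 2)), then cs(k(Kₙ)) = r. -/

import Mathlib

/-- The minimal number of generators of an ideal. -/
noncomputable def mu {R : Type*} [CommRing R] (I : Ideal R) : ℕ :=
  sInf {m : ℕ | ∃ s : Finset R, s.card = m ∧ Ideal.span (s : Set R) = I}

/-- The image `m̄` of the irrelevant maximal ideal `m = (x₁, …, xₙ)` in the quotient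
`k[x₁, …, xₙ]/I`. -/
noncomputable def mbar {k : Type*} [Field k] {n : ℕ}
    (I : Ideal (MvPolynomial (Fin n) k)) : Ideal (MvPolynomial (Fin n) k ⧸ I) :=
  Ideal.map (Ideal.Quotient.mk I)
    (Ideal.span (Set.range (MvPolynomial.X : Fin n → MvPolynomial (Fin n) k)))

/-- An ideal of the quotient `k[x₁, …, xₙ]/I` is homogeneous if it is generated by the
images of a set of homogeneous polynomials. -/
def IsHomogeneousQuotIdeal {k : Type*} [Field k] {n : ℕ}
    (I : Ideal (MvPolynomial (Fin n) k))
    (J : Ideal (MvPolynomial (Fin n) k ⧸ I)) : Prop :=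
  ∃ T : Set (MvPolynomial (Fin n) k),
    (∀ p ∈ T, ∃ d : ℕ, MvPolynomial.IsHomogeneous p d) ∧
    J = Ideal.map (Ideal.Quotient.mk I) (Ideal.span T)

/-- `cs` of the standard graded algebra `k[x₁, …, xₙ]/I`:
the minimum of `μ(J)` over the homogeneous ideals `J ⊆ m̄` with `J² = m̄²`. -/
noncomputable def csGr {k : Type*} [Field k] {n : ℕ}
    (I : Ideal (MvPolynomial (Fin n) k)) : ℕ :=
  sInf {m : ℕ | ∃ J : Ideal (MvPolynomial (Fin n) k ⧸ I),
    IsHomogeneousQuotIdeal I J ∧ J ≤ mbar I ∧ J ^ 2 = (mbar I) ^ 2 ∧ mu J = m}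

/-- The edge ideal of the complete graph `Kₙ`:
`I(Kₙ) = (x_i x_j : 1 ≤ i < j ≤ n)`. -/
noncomputable def edgeIdealComplete (k : Type*) [Field k] (n : ℕ) : Ideal (MvPolynomial (Fin n) k) :=
  Ideal.span {p : MvPolynomial (Fin n) k |
    ∃ i j : Fin n, i < j ∧ p = MvPolynomial.X i * MvPolynomial.X j}

section helpers
open MvPolynomial

theorem gen_sq_zero {k : Type*} [Field k] {n : ℕ} {i j : Fin n} (h : i ≠ j) :
    (Ideal.Quotient.mk (edgeIdealComplete k n) (X i)) *
      (Ideal.Quotient.mk (edgeIdealComplete k n) (X j)) = 0 := by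
  rw [← map_mul, Ideal.Quotient.eq_zero_iff_mem]
  rcases lt_or_gt_of_ne h with h | h
  · exact Ideal.subset_span ⟨i, j, h, rfl⟩
  · rw [mul_comm]
    exact Ideal.subset_span ⟨j, i, h, rfl⟩

noncomputable def phiPoly (k : Type*) [Field k] (n : ℕ) (i : Fin n) :
    MvPolynomial (Fin n) k →ₐ[k] Polynomial k :=
  aeval (fun j => if j = i then Polynomial.X else 0)

noncomputable def phi (k : Type*) [Field k] (n : ℕ) (i : Fin n) :
    (MvPolynomial (Fin n) k ⧸ edgeIdealComplete k n) →ₐ[k] Polynomial k :=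
  Ideal.Quotient.liftₐ (edgeIdealComplete k n) (phiPoly k n i) (by
    intro a ha
    have : edgeIdealComplete k n ≤ RingHom.ker (phiPoly k n i) := by
      refine Ideal.span_le.2 ?_
      rintro p ⟨a, b, hab, rfl⟩
      simp only [SetLike.mem_coe, RingHom.mem_ker, map_mul, phiPoly, aeval_X]
      by_cases h : a = i
      · have : b ≠ i := fun h' => by omega
        simp [this]
      · simp [h]
    exact this ha)

theorem phi_mk {k : Type*} [Field k] {n : ℕ} (i : Fin n) (p : MvPolynomial (Fin n) k) :
    phi k n i (Ideal.Quotient.mk _ p) = phiPoly k n i p := rfl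

theorem phi_X {k : Type*} [Field k] {n : ℕ} (i j : Fin n) :
    phi k n i (Ideal.Quotient.mk _ (X j)) = if j = i then Polynomial.X else 0 := by
  rw [phi_mk, phiPoly, aeval_X]

theorem phiPoly_coeff_zero {k : Type*} [Field k] {n : ℕ} (i : Fin n)
    (p : MvPolynomial (Fin n) k) :
    (phiPoly k n i p).coeff 0 = constantCoeff p := by
  have : (Polynomial.constantCoeff (R := k)).comp (phiPoly k n i).toRingHom
      = constantCoeff := by
    apply MvPolynomial.ringHom_ext
    · intro a; simp [phiPoly]
    · intro j
      by_cases h : j = i <;> simp [phiPoly, h]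
  exact RingHom.congr_fun this p

theorem phi_mbar_sq {k : Type*} [Field k] {n : ℕ} (i : Fin n)
    {x : MvPolynomial (Fin n) k ⧸ edgeIdealComplete k n}
    (hx : x ∈ (mbar (edgeIdealComplete k n)) ^ 2) :
    (Polynomial.X ^ 2 : Polynomial k) ∣ phi k n i x := by
  have h1 : mbar (edgeIdealComplete k n) ≤
      Ideal.comap (phi k n i).toRingHom (Ideal.span {Polynomial.X}) := by
    refine Ideal.map_le_iff_le_comap.2 (Ideal.span_le.2 ?_)
    rintro _ ⟨j, rfl⟩
    show phi k n i (Ideal.Quotient.mk _ (X j)) ∈ Ideal.span {Polynomial.X}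
    rw [phi_X]
    split_ifs
    · exact Ideal.mem_span_singleton_self _
    · exact Ideal.zero_mem _
  have h2 := (Ideal.pow_right_mono h1 2).trans (Ideal.le_comap_pow _ 2) hx
  rw [Ideal.span_singleton_pow] at h2
  exact Ideal.mem_span_singleton.1 h2

noncomputable def LL (k : Type*) [Field k] (n : ℕ) :
    (MvPolynomial (Fin n) k ⧸ edgeIdealComplete k n) →ₗ[k] (Fin n → k) :=
  LinearMap.pi fun i => (Polynomial.lcoeff k 2).comp (phi k n i).toLinearMap

theorem LL_apply {k : Type*} [Field k] {n : ℕ} (x) (i : Fin n) :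
    LL k n x i = (phi k n i x).coeff 2 := rfl

theorem lower {k : Type*} [Field k] {n : ℕ}
    (s : Finset (MvPolynomial (Fin n) k ⧸ edgeIdealComplete k n))
    (h : Ideal.span (s : Set _) ^ 2 = (mbar (edgeIdealComplete k n)) ^ 2) :
    n ≤ (s.card + 1).choose 2 := by
  classical
  set S := s.sym2.image Sym2.mul with hS
  have hspan : Ideal.span (s : Set _) ^ 2 = Ideal.span (S : Set (MvPolynomial (Fin n) k ⧸ edgeIdealComplete k n)) := by
    rw [sq, Ideal.span_mul_span']
    congr 1
    ext x
    simp only [Set.mem_mul, hS, Finset.coe_image, Set.mem_image, Finset.mem_coe]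
    constructor
    · rintro ⟨a, ha, b, hb, rfl⟩
      exact ⟨s(a, b), by simp [ha, hb], rfl⟩
    · rintro ⟨z, hz, rfl⟩
      induction z with
      | _ a b =>
        rw [Finset.mk_mem_sym2_iff] at hz
        exact ⟨a, hz.1, b, hz.2, rfl⟩
  have key : ∀ x ∈ Ideal.span (S : Set (MvPolynomial (Fin n) k ⧸ edgeIdealComplete k n)),
      LL k n x ∈ Submodule.span k ((S.image (LL k n) : Finset _) : Set (Fin n → k)) := by
    intro x hx
    induction hx using Submodule.span_induction with
    | mem x hx => exact Submodule.subset_span (by simpa using ⟨x, by simpa using hx, rfl⟩)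
    | zero => simp
    | add x y _ _ h1 h2 => rw [map_add]; exact add_mem h1 h2
    | smul a x hx ih =>
      obtain ⟨p, rfl⟩ := Ideal.Quotient.mk_surjective a
      have : LL k n (Ideal.Quotient.mk (edgeIdealComplete k n) p • x) = constantCoeff p • LL k n x := by
        ext i
        have hx' : x ∈ (mbar (edgeIdealComplete k n)) ^ 2 := by
          rw [← h, hspan]; exact hx
        obtain ⟨q, hq⟩ := phi_mbar_sq i hx'
        rw [Pi.smul_apply, LL_apply, LL_apply, smul_eq_mul, smul_eq_mul, map_mul, hq, phi_mk, mul_left_comm]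
        rw [Polynomial.coeff_X_pow_mul', Polynomial.coeff_X_pow_mul']
        simp [Polynomial.mul_coeff_zero, phiPoly_coeff_zero]
      rw [this]
      exact Submodule.smul_mem _ _ ih
  have htop : Submodule.span k ((S.image (LL k n) : Finset _) : Set (Fin n → k)) = ⊤ := by
    rw [eq_top_iff, ← (Pi.basisFun k (Fin n)).span_eq, Submodule.span_le]
    rintro _ ⟨i, rfl⟩
    have hm : (Ideal.Quotient.mk (edgeIdealComplete k n) (X i)) ^ 2 ∈
        Ideal.span (S : Set (MvPolynomial (Fin n) k ⧸ edgeIdealComplete k n)) := by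
      rw [← hspan, h]
      exact Ideal.pow_mem_pow
        (Ideal.mem_map_of_mem _ (Ideal.subset_span (Set.mem_range_self i))) 2
    have := key _ hm
    rw [SetLike.mem_coe]
    convert this using 1
    ext j
    rw [LL_apply, map_pow, phi_X]
    by_cases hij : i = j
    · subst hij; simp
    · simp [hij, Pi.single_apply, Ne.symm hij]
  have h1 := finrank_span_finset_le_card (R := k) (S.image (LL k n))
  rw [Set.finrank, htop, finrank_top, Module.finrank_fin_fun] at h1
  calc n ≤ _ := h1
    _ ≤ S.card := Finset.card_image_le
    _ ≤ s.sym2.card := Finset.card_image_le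
    _ = _ := Finset.card_sym2 s

theorem upper {k : Type*} [Field k] {n r : ℕ} (hnr : n ≤ (r + 1).choose 2) :
    ∃ v : Fin r → MvPolynomial (Fin n) k, (∀ a, (v a).IsHomogeneous 1) ∧
      Ideal.map (Ideal.Quotient.mk (edgeIdealComplete k n)) (Ideal.span (Set.range v)) ≤
        mbar (edgeIdealComplete k n) ∧
      (Ideal.map (Ideal.Quotient.mk (edgeIdealComplete k n)) (Ideal.span (Set.range v))) ^ 2 =
        mbar (edgeIdealComplete k n) ^ 2 := by
  classical
  obtain ⟨f⟩ : Nonempty (Fin n ↪ Sym2 (Fin r)) := by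
    apply Function.Embedding.nonempty_of_card_le
    rw [Sym2.card]; simpa using hnr
  let v : Fin r → MvPolynomial (Fin n) k := fun a => ∑ i, if a ∈ f i then X i else 0
  set J := Ideal.map (Ideal.Quotient.mk (edgeIdealComplete k n)) (Ideal.span (Set.range v)) with hJ
  have hle : J ≤ mbar (edgeIdealComplete k n) := by
    refine Ideal.map_mono (Ideal.span_le.2 ?_)
    rintro _ ⟨a, rfl⟩
    refine Ideal.sum_mem _ fun i _ => ?_
    split_ifs
    · exact Ideal.subset_span (Set.mem_range_self i)
    · exact Ideal.zero_mem _
  refine ⟨v, ?_, hle, le_antisymm (Ideal.pow_right_mono hle 2) ?_⟩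
  · intro a
    refine IsHomogeneous.sum _ _ _ fun i _ => ?_
    split_ifs
    · exact isHomogeneous_X _ _
    · exact isHomogeneous_zero _ _ _
  let y : Fin n → MvPolynomial (Fin n) k ⧸ edgeIdealComplete k n :=
    fun i => Ideal.Quotient.mk _ (X i)
  have hmul : ∀ a b, Ideal.Quotient.mk (edgeIdealComplete k n) (v a) *
      Ideal.Quotient.mk (edgeIdealComplete k n) (v b) =
      ∑ i, if a ∈ f i ∧ b ∈ f i then y i ^ 2 else 0 := by
    intro a b
    simp only [v, map_sum, Finset.sum_mul_sum]
    refine Finset.sum_congr rfl fun i _ => ?_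
    rw [Finset.sum_eq_single i]
    · by_cases h1 : a ∈ f i <;> by_cases h2 : b ∈ f i <;> simp [h1, h2, y, sq]
    · intro j _ hj
      have := gen_sq_zero (k := k) (Ne.symm hj)
      split_ifs <;> simp [this]
    · simp
  have hmem : ∀ a b, (∑ i, if a ∈ f i ∧ b ∈ f i then y i ^ 2 else 0) ∈ J ^ 2 := by
    intro a b
    rw [← hmul, sq]
    exact Ideal.mul_mem_mul (Ideal.mem_map_of_mem _ (Ideal.subset_span ⟨a, rfl⟩))
      (Ideal.mem_map_of_mem _ (Ideal.subset_span ⟨b, rfl⟩))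
  have hoff : ∀ i a b, a ≠ b → f i = s(a, b) → y i ^ 2 ∈ J ^ 2 := by
    intro i a b hab hi
    have := hmem a b
    rw [Finset.sum_eq_single i] at this
    · simpa [hi] using this
    · intro j _ hj
      rw [if_neg]
      intro h
      exact hj (f.injective (((Sym2.mem_and_mem_iff hab).1 h).trans hi.symm))
    · simp
  have hall : ∀ i, y i ^ 2 ∈ J ^ 2 := by
    intro i
    obtain ⟨a, b, hi⟩ : ∃ a b, f i = s(a, b) := by
      induction h : f i with
      | _ a b => exact ⟨a, b, rfl⟩
    by_cases hab : a = b
    · subst hab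
      have h1 := hmem a a
      rw [← Finset.add_sum_erase _ _ (Finset.mem_univ i)] at h1
      have h2 : (∑ j ∈ Finset.univ.erase i, if a ∈ f j ∧ a ∈ f j then y j ^ 2 else 0) ∈ J ^ 2 := by
        refine Ideal.sum_mem _ fun j hj => ?_
        split_ifs with h
        · obtain ⟨c, hc⟩ := h.1
          refine hoff j a c ?_ hc
          rintro rfl
          exact (Finset.ne_of_mem_erase hj) (f.injective (hc.trans hi.symm))
        · exact Ideal.zero_mem _
      have h3 := (Ideal.add_mem_iff_left _ h2).1 h1
      simpa [hi] using h3
    · exact hoff i a b hab hi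
  rw [mbar, Ideal.map_span, sq (Ideal.span _), Ideal.span_mul_span', Ideal.span_le]
  rintro _ ⟨_, ⟨_, ⟨i, rfl⟩, rfl⟩, _, ⟨_, ⟨j, rfl⟩, rfl⟩, rfl⟩
  by_cases h : i = j
  · subst h
    have := hall i
    rw [sq (y i)] at this
    exact this
  · show _ * _ ∈ _
    rw [gen_sq_zero h]
    exact Ideal.zero_mem _

end helpers

/-- Let `k(Kₙ) = k[x₁, …, xₙ]/I(Kₙ)` be the edge ring of the complete graph on
`n ≥ 1` vertices.  If `r ≥ 1` is the smallest integer with `n ≤ (r+1 choose 2)`,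
then `cs(k(Kₙ)) = r`. -/
theorem stmt18 {k : Type*} [Field k] (n : ℕ) (hn : 1 ≤ n) (r : ℕ) (hr : 1 ≤ r)
    (hnr : n ≤ (r + 1).choose 2)
    (hmin : ∀ s : ℕ, 1 ≤ s → n ≤ (s + 1).choose 2 → r ≤ s) :
    csGr (edgeIdealComplete k n) = r := by
  classical
  obtain ⟨v, hv, hle, hsq⟩ := upper (k := k) hnr
  set J := Ideal.map (Ideal.Quotient.mk (edgeIdealComplete k n)) (Ideal.span (Set.range v)) with hJ
  have hJmem : ∃ J' : Ideal (MvPolynomial (Fin n) k ⧸ edgeIdealComplete k n),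
      IsHomogeneousQuotIdeal _ J' ∧ J' ≤ mbar _ ∧ J' ^ 2 = (mbar _) ^ 2 ∧ mu J' = mu J :=
    ⟨J, ⟨Set.range v, by rintro _ ⟨a, rfl⟩; exact ⟨1, hv a⟩, rfl⟩, hle, hsq, rfl⟩
  apply le_antisymm
  · refine (Nat.sInf_le hJmem).trans ?_
    set t : Finset (MvPolynomial (Fin n) k ⧸ edgeIdealComplete k n) :=
      Finset.univ.image (fun a => Ideal.Quotient.mk _ (v a)) with ht
    have h1 : mu J ≤ t.card := by
      refine Nat.sInf_le ⟨t, rfl, ?_⟩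
      rw [hJ, Ideal.map_span, ht, Finset.coe_image, Finset.coe_univ, Set.image_univ,
        ← Set.range_comp]
      rfl
    exact h1.trans (Finset.card_image_le.trans (by simp))
  · refine le_csInf ⟨_, hJmem⟩ ?_
    rintro m ⟨J', -, -, hsq', rfl⟩
    have hne : {m : ℕ | ∃ s : Finset (MvPolynomial (Fin n) k ⧸ edgeIdealComplete k n),
        s.card = m ∧ Ideal.span (s : Set _) = J'}.Nonempty := by
      obtain ⟨s, hs⟩ := (isNoetherianRing_iff_ideal_fg _).1
        (inferInstance : IsNoetherianRing (MvPolynomial (Fin n) k ⧸ edgeIdealComplete k n)) J'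
      exact ⟨_, s, rfl, hs⟩
    obtain ⟨s, hs, hspan⟩ := Nat.sInf_mem hne
    have hl := lower s (by rw [hspan]; exact hsq')
    have h2 : n ≤ (mu J' + 1).choose 2 := by rw [mu, ← hs]; exact hl
    refine hmin _ ?_ h2
    by_contra h0
    have : mu J' = 0 := by omega
    rw [this] at h2
    simp at h2
    omega
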